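/- arXiv:2508.11465 — 6 statements merged into one kernel-verified Lean document; each statement's English description precedes it below -/
import Mathlib

section
/- If a small category C is not confluent, then there exists a functor D : Cᵒᵖ ⥤ Type whose value at every object is a finite nonempty set and which has no solution (its set of sections is empty). -/
open CategoryTheory Opposite

universe v u

/-- A category is confluent if any two objects connected by a zigzag admit a cocone. -/
def Confluent (C : Type u) [Category.{v} C] : Prop :=
  ∀ A B : C, Zigzag A B → ∃ (Z : C) (_ : A ⟶ Z) (_ : B ⟶ Z), True

/-- The subfunctor of the constant presheaf on `Bool` in which only `true` is allowed at objects
receiving an arrow from `A` and only `false` at objects receiving an arrow from `B`. -/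
def separatingPresheaf {C : Type} [SmallCategory C] (A B : C) : Cᵒᵖ ⥤ Type where
  obj X := {b : Bool // (Nonempty (A ⟶ X.unop) → b = true) ∧ (Nonempty (B ⟶ X.unop) → b = false)}
  map f := ↾fun b => ⟨b.1, fun ⟨a⟩ => b.2.1 ⟨a ≫ f.unop⟩, fun ⟨a⟩ => b.2.2 ⟨a ≫ f.unop⟩⟩

theorem separatingPresheaf_section_eq_of_zigzag {C : Type} [SmallCategory C] {A B : C}
    {x : ∀ X, (separatingPresheaf A B).obj X} (hx : x ∈ (separatingPresheaf A B).sections)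
    {X Y : C} (h : Zigzag X Y) : (x (op X)).1 = (x (op Y)).1 := by
  have key : ∀ {X Y : C}, (X ⟶ Y) → (x (op X)).1 = (x (op Y)).1 := fun f =>
    (congrArg Subtype.val (hx f.op)).symm
  induction h with
  | refl => rfl
  | tail _ hz ih =>
    rcases hz with ⟨⟨f⟩⟩ | ⟨⟨f⟩⟩
    · exact ih.trans (key f)
    · exact ih.trans (key f).symm

theorem not_confluent_no_solution (C : Type) [SmallCategory C]
    (h : ¬ Confluent C) :
    ∃ D : Cᵒᵖ ⥤ Type,
      (∀ X : Cᵒᵖ, Finite (D.obj X)) ∧ (∀ X : Cᵒᵖ, Nonempty (D.obj X)) ∧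
        D.sections = ∅ := by
  simp only [Confluent, not_forall] at h
  obtain ⟨A, B, hAB, hno⟩ := h
  refine ⟨separatingPresheaf A B, fun X => Subtype.finite, fun X => ?_, ?_⟩
  · by_cases hA : Nonempty (A ⟶ X.unop)
    · exact ⟨⟨true, fun _ => rfl, fun ⟨b⟩ => (hno ⟨_, hA.some, b, trivial⟩).elim⟩⟩
    · exact ⟨⟨false, fun a => (hA a).elim, fun _ => rfl⟩⟩
  · refine Set.eq_empty_of_forall_notMem fun x hx => ?_
    have hxA : (x (op A)).1 = true := (x (op A)).2.1 ⟨𝟙 A⟩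
    have hxB : (x (op B)).1 = false := (x (op B)).2.2 ⟨𝟙 B⟩
    have := separatingPresheaf_section_eq_of_zigzag hx hAB
    simp [hxA, hxB] at this
end

section
/- Let C be a small, connected, confluent category with the Ramsey property, let M be a finite set of arrows of C, and let D : Cᵒᵖ ⥤ Type be a functor whose value at every object is a finite nonempty set. Then D has an M-solution: a family (x_X)_{X ∈ C} with x_X ∈ D(X) such that x_A = D(f)(x_B) for every arrow f : A ⟶ B belonging to M. -/
open CategoryTheory Opposite

universe v u

/-- The Ramsey property of a category. -/
def RamseyProp (C : Type u) [Category.{v} C] : Prop :=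
  ∀ (A B : C) (N : Type) (_ : Finite N), ∃ Z : C,
    ∀ χ : (A ⟶ Z) → N, ∃ g : B ⟶ Z,
      ∀ f f' : A ⟶ B, χ (f ≫ g) = χ (f' ≫ g)

/-- In a nonempty, connected, confluent category, every finite set of objects has an upper bound. -/
theorem Confluent.exists_upper_bound {C : Type u} [Category.{v} C] [Nonempty C]
    (hconf : Confluent C) (hconn : ∀ A B : C, Zigzag A B) {S : Set C} (hS : S.Finite) :
    ∃ B : C, ∀ A ∈ S, Nonempty (A ⟶ B) := by
  induction S, hS using Set.Finite.induction_on with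
  | empty => exact ⟨Classical.arbitrary C, by simp⟩
  | @insert A S _ _ ih =>
    obtain ⟨B, hB⟩ := ih
    obtain ⟨Z, i, j, -⟩ := hconf A B (hconn A B)
    refine ⟨Z, ?_⟩
    rintro A' (rfl | hA')
    · exact ⟨i⟩
    · exact (hB A' hA').map (· ≫ j)

/-- In a Ramsey category, for each object `B` and each finite set `S` of objects, some element of
`D B` has the same restriction along all arrows `A ⟶ B`, for every `A ∈ S`. -/
theorem RamseyProp.exists_restriction_eq {C : Type u} [Category.{v} C] (hram : RamseyProp C)
    (D : Cᵒᵖ ⥤ Type) (hfin : ∀ X : Cᵒᵖ, Finite (D.obj X)) (hne : ∀ X : Cᵒᵖ, Nonempty (D.obj X))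
    {S : Set C} (hS : S.Finite) (B : C) :
    ∃ y : D.obj (op B), ∀ A ∈ S, ∀ f f' : A ⟶ B, D.map f.op y = D.map f'.op y := by
  induction S, hS using Set.Finite.induction_on generalizing B with
  | empty => exact ⟨(hne _).some, by simp⟩
  | @insert A S _ _ ih =>
    obtain ⟨Z, hZ⟩ := hram A B (D.obj (op A)) (hfin _)
    obtain ⟨y, hy⟩ := ih Z
    obtain ⟨g, hg⟩ := hZ fun h => D.map h.op y
    refine ⟨D.map g.op y, ?_⟩
    rintro A' (rfl | hA') f f'
    · simpa using hg f f'
    · simpa using hy A' hA' (f ≫ g) (f' ≫ g)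

theorem finite_arrow_set_solution (C : Type) [SmallCategory C]
    (hconn : ∀ A B : C, Zigzag A B)
    (hconf : Confluent C) (hram : RamseyProp C)
    (M : Set (Arrow C)) (hM : M.Finite)
    (D : Cᵒᵖ ⥤ Type)
    (hfin : ∀ X : Cᵒᵖ, Finite (D.obj X)) (hne : ∀ X : Cᵒᵖ, Nonempty (D.obj X)) :
    ∃ x : ∀ X : C, D.obj (op X),
      ∀ a ∈ M, D.map a.hom.op (x a.right) = x a.left := by
  classical
  rcases isEmpty_or_nonempty C with hC | hC
  · exact ⟨fun X => (hC.false X).elim, fun a => (hC.false a.left).elim⟩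
  have hS : ((fun a : Arrow C => a.left) '' M ∪ (fun a : Arrow C => a.right) '' M).Finite :=
    (hM.image _).union (hM.image _)
  obtain ⟨B, hB⟩ := hconf.exists_upper_bound hconn hS
  obtain ⟨y, hy⟩ := hram.exists_restriction_eq D hfin hne hS B
  refine ⟨fun X => if h : Nonempty (X ⟶ B) then D.map h.some.op y else (hne _).some, ?_⟩
  intro a ha
  have hl := Set.mem_union_left ((fun a : Arrow C => a.right) '' M)
    (Set.mem_image_of_mem (fun a : Arrow C => a.left) ha)
  have hr := Set.mem_union_right ((fun a : Arrow C => a.left) '' M)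
    (Set.mem_image_of_mem (fun a : Arrow C => a.right) ha)
  have hBl : Nonempty (a.left ⟶ B) := hB _ hl
  have hBr : Nonempty (a.right ⟶ B) := hB _ hr
  beta_reduce
  rw [dif_pos hBl, dif_pos hBr]
  simpa using hy a.left hl (a.hom ≫ hBr.some) hBl.some
end

section
/- Let C be a small, confluent category with the Ramsey property and let D : Cᵒᵖ ⥤ Type be a functor whose value at every object is a finite nonempty set. Then D has a solution (its set of sections is nonempty). -/
open CategoryTheory Opposite

universe v u

/-- In a confluent category, finitely many objects of one connected component have a common
upper bound in that component. -/
theorem Confluent.exists_bound {C : Type u} [Category.{v} C] (hconf : Confluent C)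
    (S : Finset C) (X : C) :
    ∃ B : C, Zigzag X B ∧ ∀ A ∈ S, Zigzag X A → Nonempty (A ⟶ B) := by
  classical
  induction S using Finset.induction_on with
  | empty => exact ⟨X, .refl X, by simp⟩
  | insert A S _ ih =>
    obtain ⟨B, hXB, hB⟩ := ih
    by_cases hA : Zigzag X A
    · obtain ⟨Z, a, b, -⟩ := hconf A B (hA.symm.trans hXB)
      refine ⟨Z, hXB.trans (Zigzag.of_hom b), fun A' hA' hXA' => ?_⟩
      rcases Finset.mem_insert.1 hA' with rfl | hA'
      · exact ⟨a⟩
      · exact (hB A' hA' hXA').map (· ≫ b)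
    · refine ⟨B, hXB, fun A' hA' hXA' => ?_⟩
      rcases Finset.mem_insert.1 hA' with rfl | hA'
      · exact absurd hXA' hA
      · exact hB A' hA' hXA'

/-- Iterating the Ramsey property over finitely many objects: every element of `D.obj (op Z)` pulls
back along some arrow `B ⟶ Z` to an element whose restrictions to each `A ∈ S` all agree. -/
theorem RamseyProp.exists_forall_map_eq {C : Type u} [Category.{v} C] (hram : RamseyProp C)
    (D : Cᵒᵖ ⥤ Type) (hfin : ∀ X : Cᵒᵖ, Finite (D.obj X)) (S : Finset C) (B : C) :
    ∃ Z : C, ∀ z : D.obj (op Z), ∃ g : B ⟶ Z, ∀ A ∈ S, ∀ f f' : A ⟶ B,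
      D.map (f ≫ g).op z = D.map (f' ≫ g).op z := by
  classical
  induction S using Finset.induction_on generalizing B with
  | empty => exact ⟨B, fun _ => ⟨𝟙 B, by simp⟩⟩
  | insert A S _ ih =>
    obtain ⟨Y, hY⟩ := hram A B (D.obj (op A)) (hfin _)
    obtain ⟨Z, hZ⟩ := ih Y
    refine ⟨Z, fun z => ?_⟩
    obtain ⟨h, hh⟩ := hZ z
    obtain ⟨g, hg⟩ := hY fun k => D.map (k ≫ h).op z
    refine ⟨g ≫ h, fun A' hA' f f' => ?_⟩
    simp only [← Category.assoc]
    rcases Finset.mem_insert.1 hA' with rfl | hA'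
    · exact hg f f'
    · exact hh A' hA' _ _

/-- Over a finite set of objects, a functor with finite nonempty values has a partial section. -/
theorem RamseyProp.exists_partial_section {C : Type u} [Category.{v} C]
    (hconf : Confluent C) (hram : RamseyProp C) (D : Cᵒᵖ ⥤ Type)
    (hfin : ∀ X : Cᵒᵖ, Finite (D.obj X)) (hne : ∀ X : Cᵒᵖ, Nonempty (D.obj X)) (S : Finset C) :
    ∃ x : ∀ X : C, D.obj (op X), ∀ A ∈ S, ∀ B ∈ S, ∀ f : A ⟶ B, D.map f.op (x B) = x A := by
  classical
  have bound (c : Quotient (Zigzag.setoid C)) : ∃ (Z : C) (y : D.obj (op Z)),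
      (∀ A ∈ S, Zigzag c.out A → Nonempty (A ⟶ Z)) ∧
      ∀ A ∈ S, ∀ f f' : A ⟶ Z, D.map f.op y = D.map f'.op y := by
    obtain ⟨B, -, hB⟩ := hconf.exists_bound S c.out
    obtain ⟨Z, hZ⟩ := hram.exists_forall_map_eq D hfin S B
    obtain ⟨z⟩ := hne (op Z)
    obtain ⟨g, hg⟩ := hZ z
    refine ⟨B, D.map g.op z, hB, fun A hA f f' => ?_⟩
    simpa using hg A hA f f'
  choose Z y hZ hy using bound
  let comp (A : C) : Quotient (Zigzag.setoid C) := Quotient.mk _ A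
  have arrow (A : C) (hA : A ∈ S) : Nonempty (A ⟶ Z (comp A)) :=
    hZ _ A hA (Quotient.mk_out (s := Zigzag.setoid C) A)
  let x (A : C) : D.obj (op A) :=
    if h : Nonempty (A ⟶ Z (comp A)) then D.map h.some.op (y (comp A)) else (hne _).some
  have hx (A : C) (hA : A ∈ S) (c) (hc : comp A = c) (f : A ⟶ Z c) : x A = D.map f.op (y c) := by
    subst hc
    simp only [x, dif_pos (arrow A hA)]
    exact hy _ A hA _ _
  refine ⟨x, fun A hA B hB f => ?_⟩
  obtain ⟨h⟩ := arrow B hB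
  have hAB : comp A = comp B := Quotient.sound (s := Zigzag.setoid C) (Zigzag.of_hom f)
  rw [hx A hA _ hAB (f ≫ h), hx B hB _ rfl h]
  simp

theorem ramsey_implies_konig (C : Type) [SmallCategory C]
    (hconf : Confluent C) (hram : RamseyProp C)
    (D : Cᵒᵖ ⥤ Type)
    (hfin : ∀ X : Cᵒᵖ, Finite (D.obj X)) (hne : ∀ X : Cᵒᵖ, Nonempty (D.obj X)) :
    D.sections.Nonempty := by
  classical
  choose x hx using hram.exists_partial_section hconf D hfin hne
  obtain ⟨χ, hχ⟩ := Finset.rado_selection x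
  refine ⟨fun X => χ X.unop, fun {B A} f => ?_⟩
  obtain ⟨T, hT, h⟩ := hχ {A.unop, B.unop}
  beta_reduce
  rw [h A.unop (by simp), h B.unop (by simp)]
  exact hx T _ (hT (by simp)) _ (hT (by simp)) f.unop
end

section
/- Let C be a small, locally finite category such that every functor D : Cᵒᵖ ⥤ Type whose value at every object is a finite nonempty set has a solution (nonempty set of sections). Then C has the Ramsey property. -/
open CategoryTheory Opposite

universe v u

/-- The presheaf of colorings of `Hom(A, -)` for which no arrow out of `B` is monochromatic. -/
def badColorings {C : Type} [SmallCategory C] (A B : C) (N : Type) : Cᵒᵖ ⥤ Type where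
  obj Z := {χ : (A ⟶ Z.unop) → N // ∀ g : B ⟶ Z.unop, ∃ f f' : A ⟶ B, χ (f ≫ g) ≠ χ (f' ≫ g)}
  map h := TypeCat.ofHom fun χ => ⟨fun f => χ.1 (f ≫ h.unop), fun g => by
    simpa only [Category.assoc] using χ.2 (g ≫ h.unop)⟩
  map_id Z := by ext χ; simp
  map_comp h k := by ext χ; simp

theorem badColorings_sections_eq_empty {C : Type} [SmallCategory C] (A B : C) (N : Type) :
    (badColorings A B N).sections = ∅ := by
  refine Set.eq_empty_of_forall_notMem fun x hx => ?_
  have hconst (f : A ⟶ B) : (x (op B)).1 f = (x (op A)).1 (𝟙 A) := by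
    rw [← hx f.op]
    exact congrArg (x (op B)).1 (Category.id_comp f).symm
  obtain ⟨f, f', hne⟩ := (x (op B)).2 (𝟙 B)
  exact hne ((hconst _).trans (hconst _).symm)

theorem konig_implies_ramsey (C : Type) [SmallCategory C]
    (hlf : ∀ A B : C, Finite (A ⟶ B))
    (hsol : ∀ D : Cᵒᵖ ⥤ Type,
      (∀ X : Cᵒᵖ, Finite (D.obj X)) → (∀ X : Cᵒᵖ, Nonempty (D.obj X)) →
        D.sections.Nonempty) :
    RamseyProp C := by
  intro A B N _
  by_contra! h
  refine (hsol (badColorings A B N) (fun X => ?_) (fun X => ?_)).ne_empty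
    (badColorings_sections_eq_empty A B N)
  · have := hlf A X.unop
    exact Subtype.finite
  · obtain ⟨χ, hχ⟩ := h X.unop
    exact ⟨⟨χ, hχ⟩⟩
end

section
/- Let π : E ⥤ C be a precompact expansion, where C is confluent and E is small, locally finite, confluent and has the Ramsey property. Then π is a core if and only if every homomorphism of expansions to π is surjective on objects. -/
open CategoryTheory Opposite

universe v u v' u'

/-- An (abstract) expansion: a functor that is surjective on objects and a
discrete fibration. -/
structure IsExpansion {E : Type u} {C : Type u'} [Category.{v} E] [Category.{v'} C]
    (π : E ⥤ C) : Prop where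
  surj : ∀ c : C, ∃ e : E, π.obj e = c
  fib : ∀ (e : E) (c : C) (f : c ⟶ π.obj e),
    ∃! p : Σ e' : E, e' ⟶ e, ∃ h : π.obj p.1 = c, π.map p.2 = eqToHom h ≫ f

/-- An expansion is precompact if all of its fibers on objects are finite. -/
def Precompact {E : Type u} {C : Type u'} [Category.{v} E] [Category.{v'} C]
    (π : E ⥤ C) : Prop :=
  ∀ c : C, {e : E | π.obj e = c}.Finite

/-- An expansion is a core if all of its endomorphisms are bijective on objects. -/
def IsCore {E : Type u} {C : Type u'} [Category.{v} E] [Category.{v'} C]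
    (π : E ⥤ C) : Prop :=
  ∀ α : E ⥤ E, α ⋙ π = π → Function.Bijective α.obj

namespace IsExpansion

section Lifting

variable {E : Type u} {C : Type u'} [Category.{v} E] [Category.{v'} C] {π : E ⥤ C}

/-- Arrows of the base lift along an expansion, with a prescribed codomain. -/
theorem exists_lift (hπ : IsExpansion π) {c' c : C} (f : c' ⟶ c) (a : E) (ha : π.obj a = c) :
    ∃ (a' : E) (ha' : π.obj a' = c') (k : a' ⟶ a),
      π.map k = eqToHom ha' ≫ f ≫ eqToHom ha.symm := by
  obtain ⟨⟨a', k⟩, ⟨ha', hk⟩, -⟩ := hπ.fib a c' (f ≫ eqToHom ha.symm)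
  exact ⟨a', ha', k, hk⟩

theorem lift_unique (hπ : IsExpansion π) {c : C} {a a₁ a₂ : E} (f : c ⟶ π.obj a)
    {k₁ : a₁ ⟶ a} {k₂ : a₂ ⟶ a} (h₁ : π.obj a₁ = c) (h₂ : π.obj a₂ = c)
    (hk₁ : π.map k₁ = eqToHom h₁ ≫ f) (hk₂ : π.map k₂ = eqToHom h₂ ≫ f) :
    (⟨a₁, k₁⟩ : Σ e : E, e ⟶ a) = ⟨a₂, k₂⟩ :=
  (hπ.fib a c f).unique ⟨h₁, hk₁⟩ ⟨h₂, hk₂⟩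

theorem faithful (hπ : IsExpansion π) : π.Faithful where
  map_injective {a b} k₁ k₂ h := by
    have := hπ.lift_unique (π.map k₂) (k₁ := k₁) (k₂ := k₂) rfl rfl (by simpa using h) (by simp)
    simpa using this

end Lifting

end IsExpansion

/-- The objects in `S` lying in the same fiber of `π` as `e`. -/
abbrev FiberIn {E : Type u} {C : Type u'} [Category.{v} E] [Category.{v'} C]
    (π : E ⥤ C) (S : Set E) (e : E) : Type u :=
  {s : E // s ∈ S ∧ π.obj s = π.obj e}

/-- `x'` is the restriction of `x` along `π.map h`: some arrow `x' ⟶ x` lies over `π.map h`. -/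
def IsRestriction {E : Type u} {C : Type u'} [Category.{v} E] [Category.{v'} C]
    (π : E ⥤ C) {S : Set E} {e' e : E} (h : e' ⟶ e)
    (x' : FiberIn π S e') (x : FiberIn π S e) : Prop :=
  ∃ k : x'.1 ⟶ x.1, π.map k = eqToHom x'.2.2 ≫ π.map h ≫ eqToHom x.2.2.symm

section Restriction

variable {E : Type u} {C : Type u'} [Category.{v} E] [Category.{v'} C] {π : E ⥤ C} {S : Set E}

theorem IsExpansion.exists_isRestriction (hπ : IsExpansion π)
    (hS : ∀ {a b : E}, (a ⟶ b) → b ∈ S → a ∈ S) {e' e : E} (h : e' ⟶ e) (x : FiberIn π S e) :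
    ∃ x' : FiberIn π S e', IsRestriction π h x' x := by
  obtain ⟨a', ha', k, hk⟩ := hπ.exists_lift (π.map h) x.1 x.2.2
  exact ⟨⟨a', hS k x.2.1, ha'⟩, k, hk⟩

theorem IsRestriction.of_comp (hπ : IsExpansion π)
    (hS : ∀ {a b : E}, (a ⟶ b) → b ∈ S → a ∈ S) {e' e z : E} {h : e' ⟶ e} {f : e ⟶ z}
    {x' : FiberIn π S e'} {x : FiberIn π S e} {s : FiberIn π S z}
    (h' : IsRestriction π (h ≫ f) x' s) (hx : IsRestriction π f x s) :
    IsRestriction π h x' x := by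
  obtain ⟨y, l, hl⟩ := hπ.exists_isRestriction hS h x
  obtain ⟨k', hk'⟩ := h'
  obtain ⟨k, hk⟩ := hx
  have := hπ.lift_unique (π.map (h ≫ f) ≫ eqToHom s.2.2.symm) (k₁ := k') (k₂ := l ≫ k)
    x'.2.2 y.2.2 hk' (by simp [hk, hl])
  obtain rfl : x' = y := Subtype.ext (congrArg Sigma.fst this)
  exact ⟨l, hl⟩

/-- A choice of fiber elements compatible with restriction is an endomorphism. -/
theorem IsExpansion.exists_endomorphism_of_isRestriction (hπ : IsExpansion π)
    (φ : ∀ e, FiberIn π S e)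
    (hφ : ∀ {e' e : E} (h : e' ⟶ e), IsRestriction π h (φ e') (φ e)) :
    ∃ α : E ⥤ E, α ⋙ π = π ∧ ∀ e, α.obj e ∈ S := by
  have := hπ.faithful
  choose m hm using @hφ
  refine ⟨{ obj := fun e => (φ e).1
            map := fun h => m h
            map_id := fun e => π.map_injective (by simp [hm])
            map_comp := fun f g => π.map_injective (by simp [hm]) }, ?_, fun e => (φ e).2.1⟩
  exact CategoryTheory.Functor.ext (fun e => (φ e).2.2) (fun _ _ h => hm h)

end Restriction

theorem Confluent.exists_upper_bound_s10 {E : Type u} [Category.{v} E] (hE : Confluent E)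
    (c : ConnectedComponents E) (T : Finset E) :
    ∃ B : E, (Quotient.mk _ B : ConnectedComponents E) = c ∧
      ∀ e ∈ T, (Quotient.mk _ e : ConnectedComponents E) = c → Nonempty (e ⟶ B) := by
  classical
  induction T using Finset.induction_on with
  | empty =>
    obtain ⟨B, hB⟩ := Quotient.exists_rep c
    exact ⟨B, hB, by simp⟩
  | insert a T _ ih =>
    obtain ⟨B, hB, hT⟩ := ih
    by_cases ha : (Quotient.mk _ a : ConnectedComponents E) = c
    · obtain ⟨Z, f, g, -⟩ := hE a B (Quotient.exact (ha.trans hB.symm))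
      refine ⟨Z, ?_, fun e he hec => ?_⟩
      · rw [← hB]
        exact Quotient.sound (Zigzag.of_inv g)
      · rcases Finset.mem_insert.1 he with rfl | he
        · exact ⟨f⟩
        · exact (hT e he hec).map (· ≫ g)
    · refine ⟨B, hB, fun e he hec => ?_⟩
      rcases Finset.mem_insert.1 he with rfl | he
      · exact absurd hec ha
      · exact hT e he hec

/-- The Ramsey property for finitely many objects coloured simultaneously. -/
theorem RamseyProp.exists_finset {E : Type u} [Category.{v} E] (hE : RamseyProp E)
    (N : E → Type) [∀ e, Finite (N e)] (T : Finset E) (B : E) :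
    ∃ Z : E, ∀ χ : ∀ e, (e ⟶ Z) → N e, ∃ g : B ⟶ Z,
      ∀ e ∈ T, ∀ f f' : e ⟶ B, χ e (f ≫ g) = χ e (f' ≫ g) := by
  classical
  induction T using Finset.induction_on generalizing B with
  | empty => exact ⟨B, fun _ => ⟨𝟙 B, by simp⟩⟩
  | insert a T _ ih =>
    obtain ⟨Y, hY⟩ := hE a B (N a) inferInstance
    obtain ⟨Z, hZ⟩ := ih Y
    refine ⟨Z, fun χ => ?_⟩
    obtain ⟨g, hg⟩ := hZ χ
    obtain ⟨k, hk⟩ := hY fun f => χ a (f ≫ g)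
    refine ⟨k ≫ g, fun e he f f' => ?_⟩
    rcases Finset.mem_insert.1 he with rfl | he
    · simpa using hk f f'
    · simpa using hg e he (f ≫ k) (f' ≫ k)

section Compactness

variable {E : Type} {C : Type u'} [SmallCategory E] [Category.{v'} C] {π : E ⥤ C} {S : Set E}

theorem IsExpansion.exists_isRestriction_on_component (hπ : IsExpansion π) (hpre : Precompact π)
    (hEconf : Confluent E) (hEram : RamseyProp E)
    (hS : ∀ {a b : E}, (a ⟶ b) → b ∈ S → a ∈ S) (hsurj : ∀ e, Nonempty (FiberIn π S e))
    (c : ConnectedComponents E) (T : Finset E) :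
    ∃ ψ : ∀ e, FiberIn π S e, ∀ e' ∈ T, ∀ e ∈ T, ∀ h : e' ⟶ e,
      (Quotient.mk _ e : ConnectedComponents E) = c → IsRestriction π h (ψ e') (ψ e) := by
  classical
  have (e : E) : Finite (FiberIn π S e) :=
    ((hpre (π.obj e)).subset fun _ hs => hs.2).to_subtype
  obtain ⟨B, -, hB⟩ := hEconf.exists_upper_bound_s10 c T
  obtain ⟨Z, hZ⟩ := hEram.exists_finset (FiberIn π S) T B
  obtain ⟨s⟩ := hsurj Z
  choose χ hχ using fun (e : E) (f : e ⟶ Z) => hπ.exists_isRestriction hS f s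
  obtain ⟨g, hg⟩ := hZ χ
  refine ⟨fun e => if h : Nonempty (e ⟶ B) then χ e (h.some ≫ g) else (hsurj e).some,
    fun e' he' e he h hc => ?_⟩
  have hne := hB e he hc
  have hne' : Nonempty (e' ⟶ B) := hne.map (h ≫ ·)
  beta_reduce
  rw [dif_pos hne, dif_pos hne', hg e' he' _ (h ≫ hne.some)]
  refine IsRestriction.of_comp hπ hS (f := hne.some ≫ g) ?_ (hχ _ _)
  simpa using hχ e' ((h ≫ hne.some) ≫ g)

/-- A precompact expansion with confluent Ramsey total category maps into every
sub-expansion of itself. -/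
theorem IsExpansion.exists_endomorphism_into (hπ : IsExpansion π) (hpre : Precompact π)
    (hEconf : Confluent E) (hEram : RamseyProp E)
    (hS : ∀ {a b : E}, (a ⟶ b) → b ∈ S → a ∈ S) (hsurj : ∀ e, Nonempty (FiberIn π S e)) :
    ∃ α : E ⥤ E, α ⋙ π = π ∧ ∀ e, α.obj e ∈ S := by
  classical
  have (e : E) : Finite (FiberIn π S e) :=
    ((hpre (π.obj e)).subset fun _ hs => hs.2).to_subtype
  let _ (e : E) : TopologicalSpace (FiberIn π S e) := ⊥
  have (e : E) : DiscreteTopology (FiberIn π S e) := ⟨rfl⟩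
  let K (p : Σ (e' e : E), e' ⟶ e) : Set (∀ e, FiberIn π S e) :=
    {φ | IsRestriction π p.2.2 (φ p.1) (φ p.2.1)}
  have hK (p) : IsClosed (K p) :=
    (isClosed_discrete {q : FiberIn π S p.1 × FiberIn π S p.2.1 |
      IsRestriction π p.2.2 q.1 q.2}).preimage
      ((continuous_apply p.1).prodMk (continuous_apply p.2.1))
  obtain ⟨φ, hφ⟩ : (⋂ p, K p).Nonempty := by
    refine CompactSpace.iInter_nonempty hK fun P => ?_
    choose ψ hψ using fun c => hπ.exists_isRestriction_on_component hpre hEconf hEram hS hsurj c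
      (P.image (fun p => p.1) ∪ P.image (fun p => p.2.1))
    refine ⟨fun e => ψ (Quotient.mk _ e) e, Set.mem_iInter₂.2 fun ⟨e', e, h⟩ hp => ?_⟩
    have hc : (Quotient.mk _ e' : ConnectedComponents E) = Quotient.mk _ e :=
      Quotient.sound (Zigzag.of_hom h)
    change IsRestriction π h (ψ _ e') (ψ _ e)
    rw [hc]
    exact hψ _ e' (Finset.mem_union_left _ (Finset.mem_image.2 ⟨_, hp, rfl⟩))
      e (Finset.mem_union_right _ (Finset.mem_image.2 ⟨_, hp, rfl⟩)) h rfl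
  exact hπ.exists_endomorphism_of_isRestriction φ fun h => Set.mem_iInter.1 hφ ⟨_, _, h⟩

end Compactness

/-- The image of a homomorphism of expansions is closed under precomposition. -/
theorem IsExpansion.mem_range_of_hom {E F C : Type*} [Category E] [Category F] [Category C]
    {π : E ⥤ C} (hπ : IsExpansion π) {α : F ⥤ E} (hα : IsExpansion (α ⋙ π)) {a b : E}
    (k : a ⟶ b) (hb : b ∈ Set.range α.obj) : a ∈ Set.range α.obj := by
  obtain ⟨f, rfl⟩ := hb
  obtain ⟨f', hf', l, hl⟩ := hα.exists_lift (π.map k) f rfl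
  have := hπ.lift_unique (π.map k) (k₁ := α.map l) (k₂ := k) hf' rfl (by simpa using hl) (by simp)
  exact ⟨f', congrArg Sigma.fst this⟩

/-- A fiberwise self-map with finite fibers is injective when it is surjective. -/
theorem Function.Surjective.injective_of_finite_fibers {E C : Type*} {p : E → C} {a : E → E}
    (ha : Function.Surjective a) (hp : ∀ e, p (a e) = p e) (hfin : ∀ c, {e | p e = c}.Finite) :
    Function.Injective a := by
  intro x y hxy
  let r (e : {e | p e = p x}) : {e | p e = p x} := ⟨a e.1, (hp e.1).trans e.2⟩
  have : Finite {e | p e = p x} := (hfin (p x)).to_subtype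
  have hr : Function.Surjective r := fun ⟨e, he⟩ => by
    obtain ⟨d, rfl⟩ := ha e
    exact ⟨⟨d, (hp d).symm.trans he⟩, rfl⟩
  have hy : p y = p x := by rw [← hp y, ← hxy, hp]
  have := (Finite.injective_iff_surjective.2 hr) (a₁ := ⟨x, rfl⟩) (a₂ := ⟨y, hy⟩)
    (Subtype.ext hxy)
  exact congrArg Subtype.val this

theorem core_iff_all_homs_surjective
    (C E : Type) [SmallCategory C] [SmallCategory E]
    (π : E ⥤ C) (hπ : IsExpansion π) (hpre : Precompact π)
    (hCconf : Confluent C)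
    (hlf : ∀ A B : E, Finite (A ⟶ B))
    (hEconf : Confluent E) (hEram : RamseyProp E) :
    IsCore π ↔
      ∀ (F : Type) (_ : SmallCategory F) (ρ : F ⥤ C), IsExpansion ρ →
        ∀ α : F ⥤ E, α ⋙ π = ρ → Function.Surjective α.obj := by
  constructor
  · rintro hcore F _ ρ hρ α rfl e
    obtain ⟨β, hβ, hβα⟩ := hπ.exists_endomorphism_into (S := Set.range α.obj) hpre hEconf hEram
      (hπ.mem_range_of_hom hρ) fun e => by
        obtain ⟨f, hf⟩ := hρ.surj (π.obj e)
        exact ⟨⟨α.obj f, ⟨f, rfl⟩, hf⟩⟩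
    obtain ⟨d, rfl⟩ := (hcore β hβ).surjective e
    exact hβα d
  · intro h α hα
    have hsurj := h E inferInstance π hπ α hα
    exact ⟨hsurj.injective_of_finite_fibers (fun e => Functor.congr_obj hα e) hpre, hsurj⟩
end

section
/- Let C be a small, locally finite, confluent category with the Ramsey property and let S : C ⥤ Type be a functor. Then the category of elements of S (objects: pairs (c, x) with x ∈ S(c); morphisms (c, x) ⟶ (c', x'): arrows f : c ⟶ c' with S(f)(x) = x') is confluent and has the Ramsey property. In particular, for every object A of C, the coslice category A\C (Under A) is confluent and has the Ramsey property. -/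
open CategoryTheory Opposite

universe v u v' u'

/-- A category in which the legs of every span admit a cocone is confluent; the resulting
square need not commute. -/
theorem Confluent.of_span {C : Type u} [Category.{v} C]
    (h : ∀ {A B D : C} (_ : D ⟶ A) (_ : D ⟶ B), ∃ (Z : C) (_ : A ⟶ Z) (_ : B ⟶ Z), True) :
    Confluent C := by
  intro A B hAB
  induction hAB with
  | refl => exact ⟨A, 𝟙 A, 𝟙 A, trivial⟩
  | tail _ hzag ih =>
    obtain ⟨Z, a, b, -⟩ := ih
    rcases hzag with ⟨⟨f⟩⟩ | ⟨⟨f⟩⟩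
    · obtain ⟨W, p, q, -⟩ := h b f
      exact ⟨W, a ≫ p, q, trivial⟩
    · exact ⟨Z, a, f ≫ b, trivial⟩

/-- A confluent category with the Ramsey property has amalgamation: colour the arrows out of the
apex of the span according to whether they factor through its left leg. -/
theorem RamseyProp.exists_amalgam {C : Type u} [Category.{v} C]
    (hconf : Confluent C) (hram : RamseyProp C) {A B D : C} (f : D ⟶ A) (f' : D ⟶ B) :
    ∃ (Z : C) (k : A ⟶ Z) (k' : B ⟶ Z), f ≫ k = f' ≫ k' := by
  classical
  obtain ⟨E, h, h', -⟩ := hconf A B (Zigzag.of_inv_hom f f')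
  obtain ⟨Z, hZ⟩ := hram D E Bool inferInstance
  obtain ⟨g, hg⟩ := hZ fun φ => decide (∃ k : A ⟶ Z, f ≫ k = φ)
  have hfactor : ∃ k : A ⟶ Z, f ≫ k = (f' ≫ h') ≫ g :=
    (decide_eq_decide.mp (hg (f ≫ h) (f' ≫ h'))).mp ⟨h ≫ g, by simp⟩
  obtain ⟨k, hk⟩ := hfactor
  exact ⟨Z, k, h' ≫ g, by simpa using hk⟩

theorem Confluent.elements {C : Type u} [Category.{v} C]
    (hconf : Confluent C) (hram : RamseyProp C) (S : C ⥤ Type u') : Confluent S.Elements := by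
  refine Confluent.of_span fun {A B D} f f' => ?_
  obtain ⟨Z, k, k', hk⟩ := hram.exists_amalgam hconf f.val f'.val
  refine ⟨S.elementsMk Z (S.map k A.2), ⟨k, rfl⟩, ⟨k', ?_⟩, trivial⟩
  change S.map k' B.2 = S.map k A.2
  rw [← f.2, ← f'.2, ← Functor.map_comp_apply, ← Functor.map_comp_apply, hk]

/-- Bad colourings of the sets `Hom((a, x), (Z, z))`, one for each `z`, glue to a single colouring
of `Hom(a, Z)`, since an arrow `f : a ⟶ Z` determines `z = S(f)(x)`. -/
theorem RamseyProp.elements {C : Type u} [Category.{v} C]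
    (hram : RamseyProp C) (S : C ⥤ Type u') : RamseyProp S.Elements := by
  intro A B N hN
  obtain ⟨Z, hZ⟩ := hram A.1 B.1 N hN
  by_contra! hbad
  choose χ hχ using fun z : S.obj Z => hbad (S.elementsMk Z z)
  obtain ⟨g, hg⟩ := hZ fun f => χ (S.map f A.2) ⟨f, rfl⟩
  obtain ⟨f, f', hne⟩ := hχ (S.map g B.2) ⟨g, rfl⟩
  have glue : ∀ (z : S.obj Z) (φ : A.1 ⟶ Z) (hφ : S.map φ A.2 = z),
      χ z ⟨φ, hφ⟩ = χ (S.map φ A.2) ⟨φ, rfl⟩ := by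
    rintro _ φ rfl
    rfl
  exact hne ((glue _ _ _).trans ((hg f.val f'.val).trans (glue _ _ _).symm))

theorem Confluent.of_isEquivalence {D : Type u} [Category.{v} D] {E : Type u'} [Category.{v'} E]
    (F : D ⥤ E) [F.IsEquivalence] (h : Confluent E) : Confluent D := by
  intro A B hAB
  obtain ⟨Z, a, b, -⟩ := h _ _ (zigzag_obj_of_zigzag F hAB)
  let i := F.objObjPreimageIso Z
  exact ⟨F.objPreimage Z, F.preimage (a ≫ i.inv), F.preimage (b ≫ i.inv), trivial⟩

theorem RamseyProp.of_isEquivalence {D : Type u} [Category.{v} D] {E : Type u'} [Category.{v'} E]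
    (F : D ⥤ E) [F.IsEquivalence] (h : RamseyProp E) : RamseyProp D := by
  intro A B N hN
  obtain ⟨Z, hZ⟩ := h (F.obj A) (F.obj B) N hN
  let i := F.objObjPreimageIso Z
  refine ⟨F.objPreimage Z, fun χ => ?_⟩
  obtain ⟨g, hg⟩ := hZ fun φ => χ (F.preimage (φ ≫ i.inv))
  refine ⟨F.preimage (g ≫ i.inv), fun f f' => ?_⟩
  have comp_preimage : ∀ f : A ⟶ B,
      f ≫ F.preimage (g ≫ i.inv) = F.preimage ((F.map f ≫ g) ≫ i.inv) :=
    fun f => F.map_injective (by simp)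
  rw [comp_preimage, comp_preimage]
  exact hg (F.map f) (F.map f')

/-- The comparison from the coslice under `A` to the category of elements of `Hom(A, -)`. -/
def underToElements {C : Type u} [Category.{v} C] (A : C) :
    Under A ⥤ (coyoneda.obj (op A)).Elements where
  obj X := ⟨X.right, X.hom⟩
  map f := ⟨f.right, Under.w f⟩

instance {C : Type u} [Category.{v} C] (A : C) : (underToElements A).IsEquivalence where
  faithful := ⟨fun h => Under.UnderMorphism.ext (congrArg Subtype.val h)⟩
  full := ⟨fun g => ⟨Under.homMk g.val g.2, rfl⟩⟩
  essSurj := ⟨fun Y => ⟨Under.mk (Y := Y.1) Y.2, ⟨Iso.refl _⟩⟩⟩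

theorem elements_ramsey
    (C : Type) [SmallCategory C]
    (hlf : ∀ A B : C, Finite (A ⟶ B))
    (hconf : Confluent C) (hram : RamseyProp C)
    (S : C ⥤ Type) :
    (Confluent S.Elements ∧ RamseyProp S.Elements) ∧
      ∀ A : C, Confluent (Under A) ∧ RamseyProp (Under A) :=
  ⟨⟨hconf.elements hram S, hram.elements S⟩, fun A =>
    ⟨(hconf.elements hram _).of_isEquivalence (underToElements A),
      (hram.elements _).of_isEquivalence (underToElements A)⟩⟩
end
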